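/- If the dyadic subdivision scheme converges on the delta sequence with limit function φ, then for every bounded sequence a for which a limit function exists, that limit function equals f(x) = Σ_k a_k φ(x ⊖ k). -/

import Mathlib

/-- The `n`-th binary digit of a nonnegative real `x` (digit of weight `2^n`). -/
noncomputable def rbit (x : ℝ) (n : ℤ) : ℕ := ⌊x / (2 : ℝ) ^ n⌋.toNat % 2

/-- Dyadic (carry-free, digitwise XOR) addition on the dyadic half-line `ℝ₊`:
the number whose binary digits are the XORs of the binary digits of `x` and `y`.
Since `⊕` is an involution, it coincides with dyadic subtraction `⊖`. -/
noncomputable def dAdd (x y : ℝ) : ℝ :=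
  ∑' n : ℤ, (((rbit x n) ^^^ (rbit y n) : ℕ) : ℝ) * (2 : ℝ) ^ n

/-- `W`-continuity: `f` is continuous with respect to the dyadic metric,
i.e. `f(x ⊕ h) → f(x)` as `h → 0+`, at every point of the half-line. -/
def WCont (f : ℝ → ℝ) : Prop :=
  ∀ x : ℝ, 0 ≤ x → ∀ ε : ℝ, 0 < ε → ∃ δ : ℝ, 0 < δ ∧
    ∀ h : ℝ, 0 ≤ h → h < δ → |f (dAdd x h) - f x| < ε

/-- The dyadic subdivision operator with mask `c` supported on `{0, …, N}`:
`(Sa)(α) = Σ_β c_{α ⊖ 2β} a_β` (the sum is finite since the mask is). -/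
noncomputable def Sop (c : ℕ → ℝ) (N : ℕ) (a : ℕ → ℝ) : ℕ → ℝ :=
  fun α => ∑ β ∈ Finset.range (α + N + 1), c (α ^^^ (2 * β)) * a β

/-- A bounded sequence. -/
def BddSeq (a : ℕ → ℝ) : Prop := ∃ C : ℝ, ∀ k, |a k| ≤ C

/-- The delta sequence `δ = (1, 0, 0, …)`. -/
def deltaSeq : ℕ → ℝ := fun k => if k = 0 then 1 else 0

/-- The dyadic subdivision scheme with mask `c` converges on the sequence `a`
to the `W`-continuous function `f`: `‖f(2⁻ⁿ·) − (Sⁿa)(·)‖_∞ → 0`. -/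
noncomputable def ConvergesTo (c : ℕ → ℝ) (N : ℕ) (a : ℕ → ℝ) (f : ℝ → ℝ) : Prop :=
  WCont f ∧ ∀ ε : ℝ, 0 < ε → ∃ M : ℕ, ∀ n ≥ M, ∀ k : ℕ,
    |f ((2 : ℝ) ^ (-(n : ℤ)) * k) - ((Sop c N)^[n] a) k| < ε

open Filter Topology

section Subdivision

variable {c : ℕ → ℝ} {N : ℕ}

theorem sop_sum {ι : Type*} (s : Finset ι) (w : ι → ℝ) (g : ι → ℕ → ℝ) :
    Sop c N (fun β => ∑ k ∈ s, w k * g k β) = fun α => ∑ k ∈ s, w k * Sop c N (g k) α := by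
  funext α
  simp only [Sop, Finset.mul_sum]
  rw [Finset.sum_comm]
  exact Finset.sum_congr rfl fun k _ => Finset.sum_congr rfl fun β _ => by ring

theorem sop_iterate_sum {ι : Type*} (s : Finset ι) (w : ι → ℝ) (g : ι → ℕ → ℝ) (n : ℕ) :
    (Sop c N)^[n] (fun β => ∑ k ∈ s, w k * g k β) =
      fun α => ∑ k ∈ s, w k * (Sop c N)^[n] (g k) α := by
  induction n with
  | zero => rfl
  | succ n ih => simp only [Function.iterate_succ_apply', ih, sop_sum]

theorem two_pow_mul_xor (n a b : ℕ) : 2 ^ n * (a ^^^ b) = (2 ^ n * a) ^^^ (2 ^ n * b) := by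
  have := @Nat.shiftLeft_xor_distrib n a b
  simpa [Nat.shiftLeft_eq, mul_comm] using this

theorem two_mul_xor (a b : ℕ) : 2 * (a ^^^ b) = (2 * a) ^^^ (2 * b) := by
  simpa using two_pow_mul_xor 1 a b

theorem xor_le_add (a b : ℕ) : a ^^^ b ≤ a + b := by
  induction a using Nat.strong_induction_on generalizing b with
  | _ a ih =>
    rcases Nat.eq_zero_or_pos a with rfl | ha
    · simp
    · have h := ih (a / 2) (by omega) (b / 2)
      rw [← Nat.xor_div_two] at h
      have := Nat.xor_mod_two_eq (m := a) (n := b)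
      omega

theorem sop_eq_tsum (hc : ∀ k, N < k → c k = 0) (a : ℕ → ℝ) (α : ℕ) :
    Sop c N a α = ∑' β, c (α ^^^ (2 * β)) * a β := by
  refine (tsum_eq_sum fun β hβ => ?_).symm
  rw [hc, zero_mul]
  by_contra! h
  have h₁ : 2 * β ≤ α + (α ^^^ (2 * β)) := by
    simpa using xor_le_add α (α ^^^ (2 * β))
  simp only [Finset.mem_range] at hβ
  omega

/-- The subdivision operator turns dyadic shifts by `k` into dyadic shifts by `2k`. -/
theorem sop_shift (hc : ∀ k, N < k → c k = 0) (a : ℕ → ℝ) (k : ℕ) :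
    Sop c N (fun β => a (β ^^^ k)) = fun α => Sop c N a (α ^^^ (2 * k)) := by
  funext α
  simp only [sop_eq_tsum hc]
  have hinv : Function.Involutive fun β : ℕ => β ^^^ k := fun β => by simp
  rw [← hinv.toPerm.tsum_eq]
  refine tsum_congr fun β => ?_
  simp only [Function.Involutive.coe_toPerm, two_mul_xor, Nat.xor_assoc, Nat.xor_self,
    Nat.xor_zero]
  rw [Nat.xor_comm (2 * β)]

theorem sop_iterate_shift (hc : ∀ k, N < k → c k = 0) (a : ℕ → ℝ) (k n : ℕ) :
    (Sop c N)^[n] (fun β => a (β ^^^ k)) = fun α => (Sop c N)^[n] a (α ^^^ (2 ^ n * k)) := by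
  induction n with
  | zero => simp
  | succ n ih =>
    rw [Function.iterate_succ_apply', ih, sop_shift hc]
    funext α
    rw [Function.iterate_succ_apply', pow_succ', mul_assoc]

/-- The values of `S a` on a dyadic block of length `2 ^ (q + 1)` depend only on the values of
`a` on the corresponding block of length `2 ^ q`. -/
theorem sop_congr (hc : ∀ k, N < k → c k = 0) {q : ℕ} (hq : N < 2 ^ q) {a b : ℕ → ℝ} {α : ℕ}
    (h : ∀ β, β / 2 ^ q = α / 2 ^ (q + 1) → a β = b β) : Sop c N a α = Sop c N b α := by
  refine Finset.sum_congr rfl fun β _ => ?_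
  rcases lt_or_ge N (α ^^^ (2 * β)) with hN | hN
  · simp [hc _ hN]
  · rw [h β]
    have hlt : (α ^^^ (2 * β)) / 2 ^ (q + 1) = 0 :=
      Nat.div_eq_of_lt (by rw [pow_succ]; omega)
    rw [Nat.xor_div_two_pow, pow_succ', Nat.mul_div_mul_left _ _ two_pos] at hlt
    rw [pow_succ']
    exact (Nat.xor_eq_zero_iff.mp hlt).symm

theorem sop_iterate_congr (hc : ∀ k, N < k → c k = 0) {q : ℕ} (hq : N < 2 ^ q) {a b : ℕ → ℝ}
    (n : ℕ) {α : ℕ} (h : ∀ β, β / 2 ^ q = α / 2 ^ (q + n) → a β = b β) :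
    (Sop c N)^[n] a α = (Sop c N)^[n] b α := by
  induction n generalizing α with
  | zero => exact h α rfl
  | succ n ih =>
    rw [Function.iterate_succ_apply', Function.iterate_succ_apply']
    refine sop_congr hc (q := q + n) (hq.trans_le (Nat.pow_le_pow_right two_pos (by omega)))
      fun β hβ => ih fun γ hγ => h γ ?_
    rw [hγ, hβ, add_assoc]

theorem sop_iterate_deltaSeq_eq_zero (hc : ∀ k, N < k → c k = 0) {q : ℕ} (hq : N < 2 ^ q)
    {n α : ℕ} (hα : α / 2 ^ (q + n) ≠ 0) : (Sop c N)^[n] deltaSeq α = 0 := by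
  rw [sop_iterate_congr hc hq (b := fun β => ∑ k ∈ (∅ : Finset ℕ), (0 : ℝ) * (0 : ℝ)) n,
    sop_iterate_sum ∅ (fun _ => 0) (fun _ _ => 0)]
  · simp
  · intro β hβ
    have : β ≠ 0 := by
      rintro rfl
      exact hα (by rw [← hβ, Nat.zero_div])
    simp [deltaSeq, this]

theorem sop_iterate_eq_sum (hc : ∀ k, N < k → c k = 0) {q : ℕ} (hq : N < 2 ^ q) (a : ℕ → ℝ)
    {n α : ℕ} (hα : α < 2 ^ (q + n)) :
    (Sop c N)^[n] a α =
      ∑ k ∈ Finset.range (2 ^ q), a k * (Sop c N)^[n] deltaSeq (α ^^^ (2 ^ n * k)) := by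
  rw [sop_iterate_congr hc hq
    (b := fun β => ∑ k ∈ Finset.range (2 ^ q), a k * deltaSeq (β ^^^ k)) n,
    sop_iterate_sum _ a fun k β => deltaSeq (β ^^^ k)]
  · simp only [sop_iterate_shift hc]
  · intro β hβ
    rw [Nat.div_eq_of_lt hα, Nat.div_eq_zero_iff_lt (by positivity)] at hβ
    simp [deltaSeq, hβ]

/-- At a dyadic rational the limit function is the limit of the iterates. -/
theorem ConvergesTo.tendsto_iterate {a : ℕ → ℝ} {f : ℝ → ℝ} (hf : ConvergesTo c N a f)
    (p i : ℕ) :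
    Tendsto (fun n => (Sop c N)^[p + n] a (2 ^ n * i)) atTop (𝓝 (f (i / 2 ^ p))) := by
  rw [Metric.tendsto_atTop]
  intro ε hε
  obtain ⟨M, hM⟩ := hf.2 ε hε
  refine ⟨M, fun n hn => ?_⟩
  have h := hM (p + n) (by omega) (2 ^ n * i)
  have harg : (2 : ℝ) ^ (-((p + n : ℕ) : ℤ)) * ((2 ^ n * i : ℕ) : ℝ) = i / 2 ^ p := by
    rw [zpow_neg, zpow_natCast, pow_add]
    push_cast
    field_simp
  rw [harg] at h
  rwa [Real.dist_eq, abs_sub_comm]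

theorem limit_deltaSeq_eq_zero_of_dyadic (hc : ∀ k, N < k → c k = 0) {φ : ℝ → ℝ}
    (hφ : ConvergesTo c N deltaSeq φ) {q : ℕ} (hq : N < 2 ^ q) {p i : ℕ}
    (hi : i / 2 ^ (q + p) ≠ 0) : φ (i / 2 ^ p) = 0 := by
  refine tendsto_nhds_unique (hφ.tendsto_iterate p i) (tendsto_const_nhds.congr fun n => ?_)
  refine (sop_iterate_deltaSeq_eq_zero hc hq ?_).symm
  rwa [← add_assoc, pow_add _ _ n, mul_comm, Nat.mul_div_mul_right _ _ (by positivity)]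

theorem limit_eq_sum_of_dyadic (hc : ∀ k, N < k → c k = 0) {φ : ℝ → ℝ}
    (hφ : ConvergesTo c N deltaSeq φ) {a : ℕ → ℝ} {f : ℝ → ℝ} (hf : ConvergesTo c N a f)
    {q : ℕ} (hq : N < 2 ^ q) {p i : ℕ} (hi : i < 2 ^ (q + p)) :
    f (i / 2 ^ p) =
      ∑ k ∈ Finset.range (2 ^ q), a k * φ (((i ^^^ (2 ^ p * k) : ℕ) : ℝ) / 2 ^ p) := by
  refine tendsto_nhds_unique (hf.tendsto_iterate p i) ?_
  refine (tendsto_finsetSum _ fun k _ =>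
    (hφ.tendsto_iterate p (i ^^^ (2 ^ p * k))).const_mul (a k)).congr fun n => ?_
  rw [sop_iterate_eq_sum hc hq]
  · refine Finset.sum_congr rfl fun k _ => ?_
    rw [two_pow_mul_xor, ← mul_assoc, ← pow_add, add_comm n p]
  · rw [← add_assoc, pow_add _ _ n, mul_comm]
    gcongr

end Subdivision

section DyadicAddition

theorem hasSum_binary_digits_nat (k : ℕ) :
    HasSum (fun n : ℕ => ((k / 2 ^ n % 2 : ℕ) : ℝ) * 2 ^ n) k := by
  have hsum (M : ℕ) : ∑ n ∈ Finset.range M, k / 2 ^ n % 2 * 2 ^ n = k % 2 ^ M := by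
    induction M with
    | zero => simp [Nat.mod_one]
    | succ M ih => rw [Finset.sum_range_succ, ih, Nat.mod_pow_succ, mul_comm]
  have hk : k < 2 ^ k := Nat.lt_two_pow_self
  have h := hasSum_sum_of_ne_finset_zero (L := .unconditional ℕ)
    (f := fun n : ℕ => ((k / 2 ^ n % 2 : ℕ) : ℝ) * 2 ^ n) (s := Finset.range k) fun n hn => by
      have : k < 2 ^ n := hk.trans_le (Nat.pow_le_pow_right two_pos (by simpa using hn))
      simp [Nat.div_eq_of_lt this]
  convert h
  rw [← Nat.mod_eq_of_lt hk, ← hsum k]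
  push_cast
  simp [hsum k, Nat.mod_eq_of_lt hk]

theorem rbit_natCast {x : ℝ} (n : ℕ) : rbit x n = ⌊x⌋₊ / 2 ^ n % 2 := by
  rw [rbit, Int.floor_toNat, zpow_natCast]
  have := Nat.floor_div_natCast x (2 ^ n)
  push_cast at this
  rw [this]

theorem rbit_neg {x : ℝ} (n : ℕ) :
    rbit x (-(n + 1 : ℤ)) = ⌊x * 2 ^ (n + 1)⌋₊ % 2 := by
  rw [rbit, Int.floor_toNat, zpow_neg, div_inv_eq_mul]
  norm_cast

theorem rbit_neg_natCast (k n : ℕ) : rbit k (-(n + 1 : ℤ)) = 0 := by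
  rw [rbit_neg]
  have : (k : ℝ) * 2 ^ (n + 1) = ((k * 2 ^ (n + 1) : ℕ) : ℝ) := by push_cast; rfl
  rw [this, Nat.floor_natCast, pow_succ, ← mul_assoc, Nat.mul_mod_left]

theorem rbit_neg_fract {x : ℝ} (hx : 0 ≤ x) (n : ℕ) :
    rbit (Int.fract x) (-(n + 1 : ℤ)) = rbit x (-(n + 1 : ℤ)) := by
  rw [rbit_neg, rbit_neg]
  have : x * 2 ^ (n + 1) = Int.fract x * 2 ^ (n + 1) + ((⌊x⌋₊ * 2 ^ (n + 1) : ℕ) : ℝ) := by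
    push_cast
    rw [natCast_floor_eq_intCast_floor hx, ← add_mul, Int.fract_add_floor]
  have h0 := Int.fract_nonneg x
  rw [this, Nat.floor_add_natCast (by positivity), pow_succ (2 : ℕ), ← mul_assoc,
    Nat.add_mul_mod_self_right]

theorem hasSum_binary_digits_fract {x : ℝ} (hx : 0 ≤ x) :
    HasSum (fun n : ℕ => (rbit x (-(n + 1 : ℤ)) : ℝ) * 2 ^ (-(n + 1 : ℤ))) (Int.fract x) := by
  have h := Real.hasSum_ofDigitsTerm_digits (Int.fract x) (b := 2) one_lt_two
    ⟨Int.fract_nonneg x, Int.fract_lt_one x⟩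
  convert h using 2 with n
  rw [← rbit_neg_fract hx, rbit_neg, zpow_neg, Real.ofDigitsTerm, Real.digits, Fin.val_ofNat]
  norm_cast

theorem dAdd_natCast (x : ℝ) (hx : 0 ≤ x) (j : ℕ) :
    dAdd x j = ((⌊x⌋₊ ^^^ j : ℕ) : ℝ) + Int.fract x := by
  refine (HasSum.of_nat_of_neg_add_one ?_ ?_).tsum_eq
  · convert hasSum_binary_digits_nat (⌊x⌋₊ ^^^ j) using 2 with n
    have h := @Nat.xor_mod_two_pow (⌊x⌋₊ / 2 ^ n) (j / 2 ^ n) 1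
    rw [rbit_natCast, rbit_natCast, Nat.floor_natCast, zpow_natCast, Nat.xor_div_two_pow]
    rw [pow_one] at h
    rw [h]
  · simpa only [rbit_neg_natCast, Nat.xor_zero] using hasSum_binary_digits_fract hx

theorem dAdd_fract (x : ℝ) (hx : 0 ≤ x) : dAdd x (Int.fract x) = ⌊x⌋₊ := by
  rw [← add_zero (⌊x⌋₊ : ℝ)]
  refine (HasSum.of_nat_of_neg_add_one ?_ ?_).tsum_eq
  · convert hasSum_binary_digits_nat ⌊x⌋₊ using 2 with n
    rw [rbit_natCast, rbit_natCast, zpow_natCast, Nat.floor_eq_zero.mpr (Int.fract_lt_one x)]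
    simp
  · simp only [rbit_neg_fract hx, Nat.xor_self, Nat.cast_zero, zero_mul, hasSum_zero]

theorem dAdd_div_two_pow (x y : ℝ) (p : ℕ) :
    dAdd (x / 2 ^ p) (y / 2 ^ p) = dAdd x y / 2 ^ p := by
  have hr (z : ℝ) (n : ℤ) : rbit (z / 2 ^ p) n = rbit z (n + p) := by
    rw [rbit, rbit, zpow_add₀ two_ne_zero, zpow_natCast, div_div, mul_comm]
  rw [eq_div_iff (by positivity), dAdd, ← tsum_mul_right]
  refine Eq.trans (tsum_congr fun n => ?_) ((Equiv.addRight (p : ℤ)).tsum_eq _)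
  rw [hr, hr, Equiv.coe_addRight, zpow_add₀ two_ne_zero, zpow_natCast, mul_assoc]

theorem dAdd_natCast_eq (x : ℝ) (hx : 0 ≤ x) (p k : ℕ) :
    dAdd x k = (((⌊2 ^ p * x⌋₊ ^^^ (2 ^ p * k) : ℕ) : ℝ) + Int.fract (2 ^ p * x)) / 2 ^ p := by
  rw [← dAdd_natCast _ (by positivity), ← dAdd_div_two_pow]
  congr 1 <;> push_cast <;> field_simp

theorem floor_two_pow_mul_dAdd (x : ℝ) (hx : 0 ≤ x) (p k : ℕ) :
    ⌊2 ^ p * dAdd x k⌋₊ = ⌊2 ^ p * x⌋₊ ^^^ (2 ^ p * k) := by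
  rw [dAdd_natCast_eq x hx p k, mul_div_cancel₀ _ (by positivity), add_comm,
    Nat.floor_add_natCast (Int.fract_nonneg _), Nat.floor_eq_zero.mpr (Int.fract_lt_one _), zero_add]

theorem dAdd_natCast_nonneg (x : ℝ) (hx : 0 ≤ x) (k : ℕ) : 0 ≤ dAdd x k := by
  rw [dAdd_natCast x hx]
  exact add_nonneg (Nat.cast_nonneg _) (Int.fract_nonneg _)

/-- A `W`-continuous function is the limit of its values at dyadic truncations. -/
theorem WCont.tendsto_truncation {f : ℝ → ℝ} (hf : WCont f) {x : ℝ} (hx : 0 ≤ x) :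
    Tendsto (fun p : ℕ => f (⌊2 ^ p * x⌋₊ / 2 ^ p)) atTop (𝓝 (f x)) := by
  rw [Metric.tendsto_atTop]
  intro ε hε
  obtain ⟨δ, hδ, h⟩ := hf x hx ε hε
  obtain ⟨M, hM⟩ := exists_pow_lt_of_lt_one hδ (y := (1 / 2 : ℝ)) (by norm_num)
  refine ⟨M, fun p hp => ?_⟩
  have key : dAdd x (Int.fract (2 ^ p * x) / 2 ^ p) = ⌊2 ^ p * x⌋₊ / 2 ^ p := by
    rw [← dAdd_fract _ (by positivity), ← dAdd_div_two_pow]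
    congr 1
    field_simp
  rw [Real.dist_eq, ← key]
  refine h _ (div_nonneg (Int.fract_nonneg _) (by positivity)) (lt_of_le_of_lt ?_ hM)
  calc Int.fract (2 ^ p * x) / 2 ^ p ≤ 1 / 2 ^ p := by
        gcongr
        exact (Int.fract_lt_one _).le
    _ = (1 / 2) ^ p := by rw [one_div_pow]
    _ ≤ (1 / 2) ^ M := pow_le_pow_of_le_one (by norm_num) (by norm_num) hp

theorem floor_two_pow_mul_div_two_pow (x : ℝ) (p : ℕ) : ⌊2 ^ p * x⌋₊ / 2 ^ p = ⌊x⌋₊ := by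
  have h := Nat.floor_div_natCast (2 ^ p * x) (2 ^ p)
  rw [← h]
  congr 1
  push_cast
  field_simp

end DyadicAddition

/-- If the scheme converges on the delta sequence with limit function `φ`, then
for every bounded sequence `a` for which a limit function exists, that limit
function is `f(x) = Σ_k a_k φ(x ⊖ k)`. -/
theorem limit_function_eq_sum_of_shifts
    (c : ℕ → ℝ) (N : ℕ) (hc : ∀ k, N < k → c k = 0)
    (φ : ℝ → ℝ) (hφ : ConvergesTo c N deltaSeq φ)
    (a : ℕ → ℝ) (ha : BddSeq a)
    (f : ℝ → ℝ) (hf : ConvergesTo c N a f) :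
    ∀ x : ℝ, 0 ≤ x → f x = ∑' k : ℕ, a k * φ (dAdd x k) := by
  intro x hx
  obtain ⟨q, hq⟩ : ∃ q : ℕ, N + ⌊x⌋₊ < 2 ^ q := ⟨_, Nat.lt_two_pow_self⟩
  have hN : N < 2 ^ q := by omega
  have hdiv (p : ℕ) : ⌊2 ^ p * x⌋₊ / 2 ^ (q + p) = 0 := by
    rw [add_comm, pow_add, ← Nat.div_div_eq_div_mul, floor_two_pow_mul_div_two_pow]
    exact Nat.div_eq_of_lt (by omega)
  have hlim (k : ℕ) := hφ.1.tendsto_truncation (dAdd_natCast_nonneg x hx k)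
  simp only [floor_two_pow_mul_dAdd x hx] at hlim
  have hzero (k : ℕ) (hk : k ∉ Finset.range (2 ^ q)) : a k * φ (dAdd x k) = 0 := by
    rw [tendsto_nhds_unique (hlim k) (tendsto_const_nhds.congr fun p => ?_), mul_zero]
    refine (limit_deltaSeq_eq_zero_of_dyadic hc hφ hN ?_).symm
    rw [Nat.xor_div_two_pow, hdiv, Nat.zero_xor, add_comm, pow_add,
      Nat.mul_div_mul_left _ _ (by positivity)]
    exact Nat.div_ne_zero_iff.mpr ⟨by positivity, by simpa using hk⟩
  rw [tsum_eq_sum hzero]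
  refine tendsto_nhds_unique (hf.1.tendsto_truncation hx) ?_
  refine (tendsto_finsetSum _ fun k _ => (hlim k).const_mul (a k)).congr fun p => ?_
  refine (limit_eq_sum_of_dyadic hc hφ hf hN ?_).symm
  exact (Nat.div_eq_zero_iff_lt (by positivity)).mp (hdiv p)
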